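/- For every complex number q with |q| < 1, the series \sum_{n=0}^{\infty} pod(n) q^n converges absolutely and equals (q^2; q^4)_{\infty} / (q; q)_{\infty}, i.e. \prod_{j=0}^{\infty} (1 - q^{4j+2}) / \prod_{j=0}^{\infty} (1 - q^{j+1}). -/

import Mathlib

/-- `pod n` is the number of partitions of `n` in which every odd part
appears at most once; `pod 0 = 1`. -/
noncomputable def pod (n : ℕ) : ℕ :=
  Nat.card {p : n.Partition // ∀ a : ℕ, Odd a → p.parts.count a ≤ 1}

open Finset PowerSeries Filter Topology
open scoped PowerSeries.WithPiTopology

/-- The power series `φ`, evaluated at `q`, converges absolutely with sum `s`. -/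
def HasAbsEval (q : ℂ) (φ : ℂ⟦X⟧) (s : ℂ) : Prop :=
  Summable (fun n : ℕ ↦ ‖coeff n φ * q ^ n‖) ∧ ∑' n : ℕ, coeff n φ * q ^ n = s

namespace HasAbsEval

variable {q s t : ℂ} {φ ψ : ℂ⟦X⟧}

theorem add (hφ : HasAbsEval q φ s) (hψ : HasAbsEval q ψ t) : HasAbsEval q (φ + ψ) (s + t) := by
  refine ⟨?_, ?_⟩
  · refine (hφ.1.add hψ.1).of_nonneg_of_le (fun _ ↦ norm_nonneg _) fun n ↦ ?_
    rw [map_add, add_mul]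
    exact norm_add_le _ _
  · simp_rw [map_add, add_mul]
    rw [hφ.1.of_norm.tsum_add hψ.1.of_norm, hφ.2, hψ.2]

theorem mul (hφ : HasAbsEval q φ s) (hψ : HasAbsEval q ψ t) : HasAbsEval q (φ * ψ) (s * t) := by
  have key (n : ℕ) : coeff n (φ * ψ) * q ^ n =
      ∑ kl ∈ antidiagonal n, coeff kl.1 φ * q ^ kl.1 * (coeff kl.2 ψ * q ^ kl.2) := by
    rw [coeff_mul, sum_mul]
    refine sum_congr rfl fun kl hkl ↦ ?_
    obtain rfl := mem_antidiagonal.mp hkl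
    rw [pow_add, mul_mul_mul_comm]
  simp only [HasAbsEval, key]
  refine ⟨summable_norm_sum_mul_antidiagonal_of_summable_norm
    (f := fun n ↦ coeff n φ * q ^ n) (g := fun n ↦ coeff n ψ * q ^ n) hφ.1 hψ.1, ?_⟩
  rw [← hφ.2, ← hψ.2]
  exact (tsum_mul_tsum_eq_tsum_sum_antidiagonal_of_summable_norm
    (f := fun n ↦ coeff n φ * q ^ n) (g := fun n ↦ coeff n ψ * q ^ n) hφ.1 hψ.1).symm

theorem monomial (q : ℂ) (k : ℕ) (a : ℂ) : HasAbsEval q (monomial k a) (a * q ^ k) := by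
  have h (n : ℕ) (hn : n ≠ k) : coeff n (PowerSeries.monomial k a) * q ^ n = 0 := by
    rw [coeff_monomial, if_neg hn, zero_mul]
  refine ⟨summable_of_ne_finset_zero (s := {k}) fun n hn ↦ ?_, ?_⟩
  · rw [h n (by simpa using hn), norm_zero]
  · rw [tsum_eq_single k h, coeff_monomial_same]

theorem one (q : ℂ) : HasAbsEval q 1 1 := by
  simpa using monomial q 0 1

theorem prod {ι : Type*} {f : ι → ℂ⟦X⟧} {v : ι → ℂ} (S : Finset ι)
    (h : ∀ i ∈ S, HasAbsEval q (f i) (v i)) : HasAbsEval q (∏ i ∈ S, f i) (∏ i ∈ S, v i) := by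
  classical
  induction S using Finset.induction_on with
  | empty => simpa using one q
  | insert a S ha ih =>
    rw [prod_insert ha, prod_insert ha]
    exact (h a (mem_insert_self a S)).mul (ih fun i hi ↦ h i (mem_insert_of_mem hi))

theorem of_mul_one_sub_X_pow_eq_one (hq : ‖q‖ < 1) {k : ℕ} (hk : k ≠ 0)
    (h : φ * (1 - X ^ k) = 1) : HasAbsEval q φ (1 - q ^ k)⁻¹ := by
  have hφ : φ = 1 + X ^ k * φ := by linear_combination h
  have bound (n : ℕ) : ‖coeff n φ‖ ≤ 1 := by
    induction n using Nat.strong_induction_on with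
    | _ n ih =>
      rw [hφ, map_add, coeff_X_pow_mul', coeff_one]
      rcases eq_or_ne n 0 with rfl | hn
      · simp [hk]
      · rw [if_neg hn, zero_add]
        split_ifs with hkn
        · exact ih (n - k) (by omega)
        · simp
  have hs : HasAbsEval q φ (∑' n : ℕ, coeff n φ * q ^ n) := by
    refine ⟨(summable_geometric_of_lt_one (norm_nonneg q) hq).of_nonneg_of_le
      (fun _ ↦ norm_nonneg _) fun n ↦ ?_, rfl⟩
    rw [norm_mul, norm_pow]
    exact mul_le_of_le_one_left (by positivity) (bound n)
  have h1 := hs.mul ((one q).add (monomial q k (-1)))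
  have hX : (1 : ℂ⟦X⟧) + PowerSeries.monomial k (-1) = 1 - X ^ k := by
    rw [X_pow_eq, sub_eq_add_neg, ← map_neg]
  rw [hX, h] at h1
  have h2 := h1.2.symm.trans (one q).2
  rw [← eq_inv_of_mul_eq_one_left (a := ∑' n : ℕ, coeff n φ * q ^ n)
    (by linear_combination h2)]
  exact hs

end HasAbsEval

/-- The number of partitions of `n` with distinct odd parts and all parts at most `N`. -/
noncomputable def podBounded (N n : ℕ) : ℕ :=
  Nat.card {p : n.Partition // ∀ a ∈ p.parts, a ≤ N ∧ (Odd a → p.parts.count a ≤ 1)}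

theorem podBounded_le_pod (N n : ℕ) : podBounded N n ≤ pod n := by
  refine Nat.card_le_card_of_injective _
    (Subtype.impEmbedding _ _ fun p hp a ha ↦ ?_).injective
  by_cases hmem : a ∈ p.parts
  · exact (hp a hmem).2 ha
  · simp [Multiset.count_eq_zero_of_notMem hmem]

theorem pod_le_podBounded {N n : ℕ} (h : n ≤ N) : pod n ≤ podBounded N n :=
  Nat.card_le_card_of_injective _ (Subtype.impEmbedding _ _ fun p hp a ha ↦
    ⟨(p.le_of_mem_parts ha).trans h, hp a⟩).injective

theorem podBounded_eq_pod {N n : ℕ} (h : n ≤ N) : podBounded N n = pod n :=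
  (podBounded_le_pod N n).antisymm (pod_le_podBounded h)

/-- The factor contributed by the part `i` to the generating function of `pod`. -/
noncomputable def podFactor (q : ℂ) (i : ℕ) : ℂ :=
  if Odd i then 1 + q ^ i else (1 - q ^ i)⁻¹

theorem hasAbsEval_podBounded {q : ℂ} (hq : ‖q‖ < 1) (N : ℕ) :
    HasAbsEval q (PowerSeries.mk fun n ↦ (podBounded N n : ℂ))
      (∏ i ∈ range N, podFactor q (i + 1)) := by
  classical
  let f (i c : ℕ) : ℂ := if i ≤ N ∧ (Odd i → c ≤ 1) then 1 else 0
  have hgen : PowerSeries.mk (fun n ↦ (podBounded N n : ℂ)) = Nat.Partition.genFun f := by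
    ext n
    simp_rw [coeff_mk, Nat.Partition.coeff_genFun, Finsupp.prod, f, prod_boole]
    simp [podBounded, Nat.card_eq_fintype_card, Fintype.card_subtype]
  rw [hgen, Nat.Partition.genFun_eq_tprod, tprod_eq_prod (s := range N)]
  · refine HasAbsEval.prod _ fun i hi ↦ ?_
    have hi : i + 1 ≤ N := mem_range.mp hi
    by_cases hodd : Odd (i + 1)
    · rw [podFactor, if_pos hodd, tsum_eq_single 0]
      · have hX := HasAbsEval.monomial q (i + 1) 1
        rw [← X_pow_eq, one_mul] at hX
        simpa [f, hi] using (HasAbsEval.one q).add hX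
      · intro j hj
        simp [f, hodd, hj]
    · rw [podFactor, if_neg hodd]
      refine .of_mul_one_sub_X_pow_eq_one hq i.succ_ne_zero ?_
      have hX : constantCoeff ((X : ℂ⟦X⟧) ^ (i + 1)) = 0 := by simp
      have h := WithPiTopology.tsum_pow_mul_one_sub_of_constantCoeff_eq_zero hX
      rw [(WithPiTopology.summable_pow_of_constantCoeff_eq_zero hX).tsum_eq_zero_add] at h
      simpa only [f, hi, hodd, pow_mul, pow_zero, false_imp_iff, and_self, if_true, one_smul]
        using h
  · intro i hi
    have hi : ¬ i + 1 ≤ N := by simpa using hi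
    simp [f, hi]

theorem one_sub_pow_succ_ne_zero {q : ℂ} (hq : ‖q‖ < 1) (i : ℕ) : 1 - q ^ (i + 1) ≠ 0 := by
  intro h
  have := pow_lt_one₀ (norm_nonneg q) hq i.succ_ne_zero
  rw [← norm_pow, ← sub_eq_zero.mp h, norm_one] at this
  exact this.false

theorem prod_podFactor {q : ℂ} (hq : ‖q‖ < 1) (M : ℕ) :
    ∏ i ∈ range (2 * M), podFactor q (i + 1) =
      (∏ j ∈ range M, (1 - q ^ (4 * j + 2))) / ∏ i ∈ range (2 * M), (1 - q ^ (i + 1)) := by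
  rw [eq_div_iff (prod_ne_zero_iff.mpr fun i _ ↦ one_sub_pow_succ_ne_zero hq i),
    ← prod_mul_distrib]
  induction M with
  | zero => simp
  | succ M ih =>
    rw [mul_add_one, prod_range_succ, prod_range_succ, ih, prod_range_succ _ M, mul_assoc]
    have hodd : Odd (2 * M + 1) := by simp
    have heven : ¬ Odd (2 * M + 1 + 1) := by simp [hodd.add_one]
    rw [podFactor, podFactor, if_pos hodd, if_neg heven,
      inv_mul_cancel₀ (one_sub_pow_succ_ne_zero hq _)]
    ring

theorem tendsto_prod_podFactor {q : ℂ} (hq : ‖q‖ < 1) :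
    Tendsto (fun M ↦ ∏ i ∈ range (2 * M), podFactor q (i + 1)) atTop
      (𝓝 ((∏' j : ℕ, (1 - q ^ (4 * j + 2))) / ∏' j : ℕ, (1 - q ^ (j + 1)))) := by
  have hgeom := summable_geometric_of_lt_one (norm_nonneg q) hq
  have hsum : Summable fun n : ℕ ↦ ‖-q ^ (n + 1)‖ := by
    simpa using (summable_nat_add_iff 1).mpr hgeom
  have hsum' : Summable fun n : ℕ ↦ ‖-q ^ (4 * n + 2)‖ := by
    simpa [Function.comp_def] using
      hgeom.comp_injective (i := fun n : ℕ ↦ 4 * n + 2) fun a b h ↦ by grind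
  have hden := (multipliable_one_add_of_summable hsum).tendsto_prod_tprod_nat
  have hnum := (multipliable_one_add_of_summable hsum').tendsto_prod_tprod_nat
  have hne := tprod_one_add_ne_zero_of_summable
    (fun i ↦ by simpa [sub_eq_add_neg] using one_sub_pow_succ_ne_zero hq i) hsum
  simp only [← sub_eq_add_neg] at hden hnum hne
  simp_rw [prod_podFactor hq]
  exact hnum.div (hden.comp (tendsto_id.const_mul_atTop' two_pos)) hne

theorem summable_norm_pod_mul_pow {q : ℂ} (hq : ‖q‖ < 1) :
    Summable fun n : ℕ ↦ ‖(pod n : ℂ) * q ^ n‖ := by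
  have hr : ‖((‖q‖ : ℝ) : ℂ)‖ < 1 := by simpa using hq
  obtain ⟨C, hC⟩ := (tendsto_prod_podFactor hr).norm.bddAbove_range
  refine summable_of_sum_range_le (c := C) (fun _ ↦ norm_nonneg _) fun M ↦ ?_
  obtain ⟨hs, ht⟩ := hasAbsEval_podBounded hr (2 * M)
  have hterm (n : ℕ) : ‖coeff n (PowerSeries.mk fun n ↦ (podBounded (2 * M) n : ℂ)) *
      ((‖q‖ : ℝ) : ℂ) ^ n‖ = podBounded (2 * M) n * ‖q‖ ^ n := by simp
  calc ∑ n ∈ range M, ‖(pod n : ℂ) * q ^ n‖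
      = ∑ n ∈ range M, (podBounded (2 * M) n * ‖q‖ ^ n : ℝ) := by
        refine sum_congr rfl fun n hn ↦ ?_
        rw [podBounded_eq_pod (by grind)]
        simp
    _ ≤ ∑' n : ℕ, (podBounded (2 * M) n * ‖q‖ ^ n : ℝ) :=
        Summable.sum_le_tsum _ (fun _ _ ↦ by positivity) (by simpa only [hterm] using hs)
    _ ≤ ‖((∑' n : ℕ, (podBounded (2 * M) n * ‖q‖ ^ n : ℝ) : ℝ) : ℂ)‖ := by
        rw [Complex.norm_real]
        exact le_abs_self _
    _ = ‖∏ i ∈ range (2 * M), podFactor ((‖q‖ : ℝ) : ℂ) (i + 1)‖ := by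
        rw [← ht, Complex.ofReal_tsum]
        simp
    _ ≤ C := hC ⟨M, rfl⟩

theorem pod_generating_function (q : ℂ) (hq : ‖q‖ < 1) :
    Summable (fun n : ℕ => ‖(pod n : ℂ) * q ^ n‖) ∧
    ∑' n : ℕ, (pod n : ℂ) * q ^ n =
      (∏' j : ℕ, (1 - q ^ (4 * j + 2))) / ∏' j : ℕ, (1 - q ^ (j + 1)) := by
  have hsum := summable_norm_pod_mul_pow hq
  refine ⟨hsum, tendsto_nhds_unique ?_ (tendsto_prod_podFactor hq)⟩
  simp_rw [← (hasAbsEval_podBounded hq _).2, coeff_mk]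
  refine tendsto_tsum_of_dominated_convergence hsum (fun n ↦ ?_) (.of_forall fun M n ↦ ?_)
  · refine tendsto_const_nhds.congr' ?_
    filter_upwards [eventually_ge_atTop n] with M hM
    rw [podBounded_eq_pod (by omega)]
  · rw [norm_mul, norm_mul, Complex.norm_natCast, Complex.norm_natCast]
    gcongr
    exact podBounded_le_pod _ _
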